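/- Assume H1. For each d let X^d = (X_1^d,…,X_d^d) have density π^d(x) = ∏_{i=1}^d π(x_i) and let Z^d = (Z_1^d,…,Z_d^d) be an independent standard d-dimensional Gaussian vector. Set ΔV_i^d = V(X_i^d) − V(X_i^d + ℓ d^{−1/2} Z_i^d) and b^d(x,z) = −(ℓ z/√d) V̇(x) + 2 E[ζ^d(X_1^d, Z_1^d)] − (ℓ²/(4d)) V̇(x)². Then lim_{d→∞} E[ |∑_{i=2}^d (ΔV_i^d − b^d(X_i^d, Z_i^d))| ] = 0. -/

import Mathlib

open MeasureTheory ProbabilityTheory Filter Real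
open scoped ENNReal NNReal Topology

noncomputable section

/-- The normalized target density `π(x) = exp(-V(x)) / ∫ exp(-V(y)) dy`. -/
def piDen (V : ℝ → ℝ) (x : ℝ) : ℝ := Real.exp (-V x) / ∫ y : ℝ, Real.exp (-V y)

/-- The probability measure on `ℝ` with density `π`. -/
def piMeasure (V : ℝ → ℝ) : Measure ℝ :=
  MeasureTheory.volume.withDensity (fun x => ENNReal.ofReal (piDen V x))

/-- `ζ^d(x,z) = exp((V(x) - V(x + ℓ d^{-1/2} z))/2) - 1`. -/
def zeta (V : ℝ → ℝ) (ℓ : ℝ) (d : ℕ) (x z : ℝ) : ℝ :=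
  Real.exp ((V x - V (x + ℓ * z / Real.sqrt d)) / 2) - 1

/-- The standard normal cumulative distribution function `Φ`. -/
def stdGaussCDF (s : ℝ) : ℝ := (gaussianReal 0 1 (Set.Iic s)).toReal

/-- `ΔV_i^d`-type increment: `V(x) - V(x + ℓ z/√d)`. -/
def dV (V : ℝ → ℝ) (ℓ : ℝ) (d : ℕ) (x z : ℝ) : ℝ := V x - V (x + ℓ * z / Real.sqrt d)

/-- `b^d(x,z) = -(ℓ z/√d) V̇(x) + 2 E[ζ^d(X₁,Z₁)] - (ℓ²/(4d)) V̇(x)²`. -/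
def bFun (V Vdot : ℝ → ℝ) (ℓ : ℝ) (d : ℕ) (x z : ℝ) : ℝ :=
  -(ℓ * z / Real.sqrt d) * Vdot x
    + 2 * (∫ q : ℝ × ℝ, zeta V ℓ d q.1 q.2 ∂((piMeasure V).prod (gaussianReal 0 1)))
    - ℓ ^ 2 / (4 * (d : ℝ)) * (Vdot x) ^ 2

/-- Joint law of `(X^d, Z^d)`: `X^d ∼ π^{⊗d}` independent of `Z^d ∼ N(0, I_d)`. -/
def prodPi (V : ℝ → ℝ) (d : ℕ) : Measure ((Fin d → ℝ) × (Fin d → ℝ)) :=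
  (Measure.pi fun _ : Fin d => piMeasure V).prod
    (Measure.pi fun _ : Fin d => gaussianReal 0 1)

lemma aux_exp_neg (u : ℝ) : |Real.exp u - 1 - u - u ^ 2 / 2| ≤ 3 * |u| ^ 3 * (1 + Real.exp u) := by
  have he := Real.exp_pos u
  have h3 : 0 ≤ |u| ^ 3 := by positivity
  rcases le_total 0 u with h | h
  · have := Complex.norm_exp_sub_sum_le_norm_mul_exp (u : ℂ) 3
    have h2 : (Complex.exp u - ∑ m ∈ Finset.range 3, (u : ℂ) ^ m / (m.factorial : ℂ)) =
        ((Real.exp u - 1 - u - u ^ 2 / 2 : ℝ) : ℂ) := by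
      simp [Finset.sum_range_succ]; ring
    rw [h2, Complex.norm_real, Complex.norm_real, Real.norm_eq_abs, Real.norm_eq_abs] at this
    have h4 : |u| ^ 3 * Real.exp |u| = |u| ^ 3 * Real.exp u := by rw [abs_of_nonneg h]
    rw [h4] at this
    nlinarith [mul_nonneg h3 he.le]
  · by_cases h1 : -1 ≤ u
    · have := Real.exp_bound (x := u) (abs_le.2 ⟨h1, by linarith⟩) (n := 3) (by norm_num)
      simp only [Finset.sum_range_succ, Finset.sum_range_zero] at this
      norm_num [Nat.factorial] at this
      have e : Real.exp u - 1 - u - u ^ 2 / 2 = Real.exp u - (1 + u + u ^ 2 / 2) := by ring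
      rw [e]
      nlinarith [mul_nonneg h3 he.le]
    · push Not at h1
      have e1 : Real.exp u ≤ 1 := Real.exp_le_one_iff.2 h
      have hu : |u| = -u := abs_of_nonpos h
      rw [hu] at h3 ⊢
      have h5 := mul_nonneg h3 he.le
      have h6 : -u ≤ (-u)^3 := by nlinarith [sq_nonneg u]
      have h7 : u^2 ≤ (-u)^3 := by nlinarith [sq_nonneg u]
      rw [abs_le]
      constructor <;> nlinarith

lemma aux_exp (t : ℝ) :
    |t - 2 * (Real.exp (t / 2) - 1) + t ^ 2 / 4| ≤ 3 * |t| ^ 3 * (1 + Real.exp t) := by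
  have h := aux_exp_neg (t / 2)
  have h1 : t - 2 * (Real.exp (t / 2) - 1) + t ^ 2 / 4 =
    -2 * (Real.exp (t / 2) - 1 - t / 2 - (t / 2) ^ 2 / 2) := by ring
  have h2 : Real.exp t = Real.exp (t / 2) ^ 2 := by rw [← Real.exp_nat_mul]; congr 1; ring
  have h6 : |t / 2| = |t| / 2 := by rw [abs_div]; norm_num
  rw [h1, abs_mul, h2]
  rw [h6] at h
  norm_num at h ⊢
  have h3 : 0 ≤ |t| ^ 3 := by positivity
  have h4 : 0 ≤ |t| ^ 3 * Real.exp (t / 2) ^ 2 := by positivity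
  have h5 : 0 ≤ |t| ^ 3 * (Real.exp (t / 2) - 1) ^ 2 := by positivity
  nlinarith

lemma aux_sum {Ω ι : Type*} [MeasurableSpace Ω] [Fintype ι] (ν : Measure Ω)
    [IsProbabilityMeasure ν] (Y : Ω → ℝ) (hY : MemLp Y 2 ν) (s : Finset ι) :
    ∫ w : ι → Ω, |∑ i ∈ s, Y (w i)| ∂(Measure.pi fun _ => ν)
      ≤ Real.sqrt ((s.card : ℝ) * Var[Y; ν] + ((s.card : ℝ) * ∫ x, Y x ∂ν) ^ 2) := by
  set P := Measure.pi fun _ : ι => ν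
  have hi : ∀ i, MemLp (fun w : ι → Ω => Y (w i)) 2 P := fun i =>
    hY.comp_measurePreserving (measurePreserving_eval _ i)
  have hvar : Var[∑ i ∈ s, fun w : ι → Ω => Y (w i); P] = s.card * Var[Y; ν] := by
    rw [IndepFun.variance_sum]
    · rw [Finset.sum_congr rfl (g := fun _ => Var[Y; ν]), Finset.sum_const, nsmul_eq_mul]
      intro i _
      change Var[Y ∘ (fun w : ι → Ω => w i); P] = _
      have hmp : P.map (fun w : ι → Ω => w i) = ν := (measurePreserving_eval (fun _ : ι => ν) i).map_eq
      rw [← variance_map, hmp]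
      · rw [hmp]
        exact hY.aestronglyMeasurable.aemeasurable
      · exact Measurable.aemeasurable (by fun_prop)
    · exact fun i _ => hi i
    · exact fun i _ j _ hij =>
        (iIndepFun_pi fun i ↦ hY.aestronglyMeasurable.aemeasurable).indepFun hij
  have hmean : ∫ w, (∑ i ∈ s, fun w : ι → Ω => Y (w i)) w ∂P = s.card * ∫ x, Y x ∂ν := by
    simp only [Finset.sum_apply]
    rw [integral_finsetSum _ (fun i _ => (hi i).integrable (by norm_num))]
    rw [Finset.sum_congr rfl (g := fun _ => ∫ x, Y x ∂ν), Finset.sum_const, nsmul_eq_mul]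
    intro i _
    have hmp : P.map (fun w : ι → Ω => w i) = ν := (measurePreserving_eval (fun _ : ι => ν) i).map_eq
    have := integral_map (μ := P) (φ := fun w : ι → Ω => w i) (f := Y)
      (Measurable.aemeasurable (by fun_prop)) (by rw [hmp]; exact hY.1)
    rw [hmp] at this
    exact this.symm
  have hS : MemLp (∑ i ∈ s, fun w : ι → Ω => Y (w i)) 2 P := memLp_finsetSum' s (fun i _ => hi i)
  have h1 := variance_eq_sub hS
  have h2 := variance_nonneg (|∑ i ∈ s, fun w : ι → Ω => Y (w i)|) P
  rw [variance_eq_sub hS.abs] at h2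
  rw [hvar] at h1
  apply Real.le_sqrt_of_sq_le
  have e3 : (|∑ i ∈ s, fun w : ι → Ω => Y (w i)|) ^ 2 = (∑ i ∈ s, fun w : ι → Ω => Y (w i)) ^ 2 := by
    ext w; simp
  rw [e3] at h2
  rw [hmean] at h1
  have e4 : ∫ w : ι → Ω, |∑ i ∈ s, Y (w i)| ∂P = ∫ w, |∑ i ∈ s, fun w : ι → Ω => Y (w i)| w ∂P := by
    simp
  rw [e4]
  linarith

lemma Zpos (V : ℝ → ℝ) (hVint : Integrable (fun y => Real.exp (-V y))) :
    0 < ∫ y : ℝ, Real.exp (-V y) := by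
  exact integral_exp_pos hVint

lemma piProb (V : ℝ → ℝ) (hVint : Integrable (fun y => Real.exp (-V y))) :
    IsProbabilityMeasure (piMeasure V) := by
  constructor
  rw [piMeasure, withDensity_apply _ MeasurableSet.univ, Measure.restrict_univ]
  have hZ := Zpos V hVint
  rw [← ofReal_integral_eq_lintegral_ofReal]
  · simp only [piDen]
    rw [integral_div, div_self hZ.ne', ENNReal.ofReal_one]
  · exact hVint.div_const _
  · exact ae_of_all _ fun x => div_nonneg (Real.exp_pos _).le hZ.le

lemma cov (V : ℝ → ℝ) (hV : Measurable V) (g : ℝ → ℝ≥0∞) (hg : Measurable g) (θ : ℝ) :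
    ∫⁻ x, g (V x - V (x + θ)) * ENNReal.ofReal (Real.exp (V x - V (x + θ))) ∂(piMeasure V)
      = ∫⁻ x, g (V (x + -θ) - V x) ∂(piMeasure V) := by
  have hm : Measurable fun x => ENNReal.ofReal (piDen V x) := by
    unfold piDen; fun_prop
  rw [piMeasure, lintegral_withDensity_eq_lintegral_mul _ hm (by fun_prop),
    lintegral_withDensity_eq_lintegral_mul _ hm (by fun_prop)]
  rw [← lintegral_add_right_eq_self ((fun x => ENNReal.ofReal (piDen V x)) * fun x => g (V (x + -θ) - V x)) θ]
  apply lintegral_congr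
  intro x
  simp only [Pi.mul_apply]
  rw [add_neg_cancel_right]
  have : ENNReal.ofReal (piDen V (x + θ)) =
      ENNReal.ofReal (piDen V x) * ENNReal.ofReal (Real.exp (V x - V (x + θ))) := by
    rw [← ENNReal.ofReal_mul' (Real.exp_pos _).le]
    congr 1
    unfold piDen
    rw [div_mul_eq_mul_div, ← Real.exp_add]
    congr 2; ring
  rw [this]; ring

def RR (V Vdot : ℝ → ℝ) (h : ℝ) (q : ℝ × ℝ) : ℝ :=
  V q.1 - V (q.1 + h * q.2) + h * q.2 * Vdot q.1

def DD (V : ℝ → ℝ) (h : ℝ) (q : ℝ × ℝ) : ℝ := V q.1 - V (q.1 + h * q.2)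

def GG (Vdot : ℝ → ℝ) (q : ℝ × ℝ) : ℝ := q.2 * Vdot q.1

lemma RR_meas (V Vdot : ℝ → ℝ) (hV : Measurable V) (hVdot : Measurable Vdot) (h : ℝ) :
    Measurable (RR V Vdot h) := by unfold RR; fun_prop

lemma DD_meas (V : ℝ → ℝ) (hV : Measurable V) (h : ℝ) :
    Measurable (DD V h) := by unfold DD; fun_prop

lemma GG_meas (Vdot : ℝ → ℝ) (hVdot : Measurable Vdot) :
    Measurable (GG Vdot) := by unfold GG; fun_prop

lemma moment_of_eLpNorm {Ω : Type*} [MeasurableSpace Ω] (μ : Measure Ω) (f : Ω → ℝ)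
    (hf : AEStronglyMeasurable f μ) (n : ℕ) (hn : n ≠ 0) (c : ℝ) (hc : 0 ≤ c)
    (h : eLpNorm f n μ ≤ ENNReal.ofReal c) :
    Integrable (fun x => |f x| ^ n) μ ∧ ∫ x, |f x| ^ n ∂μ ≤ c ^ n := by
  have hm : MemLp f n μ := ⟨hf, h.trans_lt ENNReal.ofReal_lt_top⟩
  have hi : Integrable (fun x => |f x| ^ n) μ := hm.integrable_norm_pow hn
  refine ⟨hi, ?_⟩
  have h1 := eLpNorm_nnreal_pow_eq_lintegral (f := f) (μ := μ) (p := (n : ℝ≥0)) (by exact_mod_cast hn)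
  have h2 : ∫⁻ x, ‖f x‖ₑ ^ (((n : ℝ≥0) : ℝ)) ∂μ = ENNReal.ofReal (∫ x, |f x| ^ n ∂μ) := by
    rw [ofReal_integral_eq_lintegral_ofReal hi (ae_of_all _ fun x => by positivity)]
    apply lintegral_congr
    intro x
    simp only [NNReal.coe_natCast, ENNReal.rpow_natCast]
    rw [ENNReal.ofReal_pow (abs_nonneg _), Real.enorm_eq_ofReal_abs]
  rw [h2] at h1
  have h3 : ENNReal.ofReal (∫ x, |f x| ^ n ∂μ) ≤ ENNReal.ofReal (c ^ n) := by
    rw [← h1, ENNReal.ofReal_pow hc]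
    simp only [NNReal.coe_natCast, ENNReal.rpow_natCast, ENNReal.coe_natCast]
    gcongr
  exact (ENNReal.ofReal_le_ofReal_iff (by positivity)).1 h3

lemma RR_bound (V Vdot : ℝ → ℝ) (hV : Measurable V) (hVdot : Measurable Vdot)
    (hVint : Integrable (fun y => Real.exp (-V y)))
    (p C β : ℝ) (hp : 4 < p) (hC : 0 < C) (hβ : 1 < β)
    (hH1i : ∀ θ : ℝ,
      Integrable (fun x => |V (x + θ) - V x - θ * Vdot x| ^ p) (piMeasure V) ∧
      (∫ x, |V (x + θ) - V x - θ * Vdot x| ^ p ∂(piMeasure V)) ^ (1 / p) ≤ C * |θ| ^ β) :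
    ∃ K : ℝ, 0 ≤ K ∧ ∀ h : ℝ, ∀ n : ℕ, n ≠ 0 → n ≤ 4 →
      Integrable (fun q => |RR V Vdot h q| ^ n) ((piMeasure V).prod (gaussianReal 0 1)) ∧
      ∫ q, |RR V Vdot h q| ^ n ∂((piMeasure V).prod (gaussianReal 0 1)) ≤ (K * |h| ^ β) ^ n := by
  have := piProb V hVint
  have hp0 : 0 < p := by linarith
  have hz : Integrable (fun z : ℝ => |z| ^ (β * p)) (gaussianReal 0 1) := by
    have hβp : 0 < β * p := by positivity
    have := (memLp_id_gaussianReal' (μ := 0) (v := 1) (ENNReal.ofReal (β * p))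
      ENNReal.ofReal_ne_top).integrable_norm_rpow (by simpa using hβp) ENNReal.ofReal_ne_top
    rw [ENNReal.toReal_ofReal hβp.le] at this
    exact this
  set M := ∫ z, |z| ^ (β * p) ∂(gaussianReal 0 1) with hM
  have hM0 : 0 ≤ M := integral_nonneg fun z => by positivity
  refine ⟨C * M ^ (1 / p), by positivity, fun h n hn hn4 => ?_⟩
  apply moment_of_eLpNorm _ _ (RR_meas V Vdot hV hVdot h).aestronglyMeasurable n hn _ (by positivity)
  have hnp : (n : ℝ≥0∞) ≤ ENNReal.ofReal p := by
    rw [← ENNReal.ofReal_natCast]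
    apply ENNReal.ofReal_le_ofReal
    have : (n : ℝ) ≤ 4 := by exact_mod_cast hn4
    linarith
  refine (eLpNorm_le_eLpNorm_of_exponent_le hnp
    (RR_meas V Vdot hV hVdot h).aestronglyMeasurable).trans ?_
  rw [eLpNorm_eq_lintegral_rpow_enorm_toReal (by simpa using hp0) ENNReal.ofReal_ne_top,
    ENNReal.toReal_ofReal hp0.le]
  have hmeas := RR_meas V Vdot hV hVdot h
  have key : ∫⁻ q, ‖RR V Vdot h q‖ₑ ^ p ∂((piMeasure V).prod (gaussianReal 0 1)) ≤
      ENNReal.ofReal ((C * |h| ^ β) ^ p * M) := by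
    rw [lintegral_prod_symm' _ (by fun_prop), hM, ← integral_const_mul,
      ofReal_integral_eq_lintegral_ofReal (hz.const_mul _) (ae_of_all _ fun x => by positivity)]
    apply lintegral_mono
    intro z
    obtain ⟨h1, h2⟩ := hH1i (h * z)
    have e1 : ∫⁻ x, ‖RR V Vdot h (x, z)‖ₑ ^ p ∂(piMeasure V) =
        ENNReal.ofReal (∫ x, |V (x + h * z) - V x - h * z * Vdot x| ^ p ∂(piMeasure V)) := by
      rw [ofReal_integral_eq_lintegral_ofReal h1 (ae_of_all _ fun x => by positivity)]
      apply lintegral_congr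
      intro x
      rw [Real.enorm_eq_ofReal_abs, ENNReal.ofReal_rpow_of_nonneg (abs_nonneg _) hp0.le]
      congr 2
      rw [← abs_neg]; congr 1
      simp only [RR]; ring
    simp only
    rw [e1]
    apply ENNReal.ofReal_le_ofReal
    have hI : 0 ≤ ∫ x, |V (x + h * z) - V x - h * z * Vdot x| ^ p ∂(piMeasure V) :=
      integral_nonneg fun x => by positivity
    have h3 := Real.rpow_le_rpow (by positivity) h2 hp0.le
    rw [← Real.rpow_mul hI, one_div, inv_mul_cancel₀ hp0.ne', Real.rpow_one] at h3
    refine h3.trans (le_of_eq ?_)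
    rw [abs_mul, Real.mul_rpow (abs_nonneg _) (abs_nonneg _), ← mul_assoc,
      Real.mul_rpow (by positivity) (by positivity), ← Real.rpow_mul (abs_nonneg z)]
  calc _ ≤ (ENNReal.ofReal ((C * |h| ^ β) ^ p * M)) ^ (1 / p) := by gcongr
    _ = ENNReal.ofReal (((C * |h| ^ β) ^ p * M) ^ (1 / p)) := by
      rw [ENNReal.ofReal_rpow_of_nonneg (by positivity) (by positivity)]
    _ ≤ _ := by
      apply ENNReal.ofReal_le_ofReal
      rw [Real.mul_rpow (by positivity) hM0, ← Real.rpow_mul (by positivity),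
        mul_one_div_cancel hp0.ne', Real.rpow_one]
      apply le_of_eq; ring

lemma GG_int (V Vdot : ℝ → ℝ) (hVdot : Measurable Vdot)
    (hVint : Integrable (fun y => Real.exp (-V y)))
    (hH1ii : Integrable (fun x => |Vdot x| ^ (6 : ℝ)) (piMeasure V)) :
    MemLp Vdot 6 (piMeasure V) ∧ MemLp (GG Vdot) 6 ((piMeasure V).prod (gaussianReal 0 1)) := by
  have := piProb V hVint
  have e6 : (6 : ℝ≥0∞).toReal = 6 := by norm_num
  have h1 : MemLp Vdot 6 (piMeasure V) := by
    rw [← integrable_norm_rpow_iff hVdot.aestronglyMeasurable (by norm_num) (by norm_num), e6]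
    exact hH1ii
  refine ⟨h1, ?_⟩
  rw [← integrable_norm_rpow_iff (GG_meas Vdot hVdot).aestronglyMeasurable (by norm_num) (by norm_num), e6]
  have hz := (memLp_id_gaussianReal' (μ := 0) (v := 1) 6 (by norm_num)).integrable_norm_rpow
    (by norm_num) (by norm_num)
  rw [e6] at hz
  have := hH1ii.mul_prod hz
  refine this.congr (ae_of_all _ fun q => ?_)
  simp only [GG, id, Real.norm_eq_abs]
  rw [abs_mul, Real.mul_rpow (abs_nonneg _) (abs_nonneg _)]; ring

lemma GG_mean (V Vdot : ℝ → ℝ) (hVint : Integrable (fun y => Real.exp (-V y))) :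
    ∫ q, GG Vdot q ∂((piMeasure V).prod (gaussianReal 0 1)) = 0 := by
  have := piProb V hVint
  have := integral_prod_mul (μ := piMeasure V) (ν := gaussianReal 0 1) Vdot (fun z => z)
  rw [integral_id_gaussianReal, mul_zero] at this
  refine Eq.trans ?_ this
  apply integral_congr_ae
  refine ae_of_all _ fun q => ?_
  simp only [GG]; ring

lemma GG_sq (V Vdot : ℝ → ℝ) (hVint : Integrable (fun y => Real.exp (-V y))) :
    ∫ q, GG Vdot q ^ 2 ∂((piMeasure V).prod (gaussianReal 0 1)) =
      ∫ q : ℝ × ℝ, Vdot q.1 ^ 2 ∂((piMeasure V).prod (gaussianReal 0 1)) := by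
  have := piProb V hVint
  have h := integral_prod_mul (μ := piMeasure V) (ν := gaussianReal 0 1)
    (fun x => Vdot x ^ 2) (fun z => z ^ 2)
  have h1 := integral_prod_mul (μ := piMeasure V) (ν := gaussianReal 0 1)
    (fun x => Vdot x ^ 2) (fun _ => (1 : ℝ))
  have hv : ∫ z, z ^ 2 ∂(gaussianReal 0 1) = 1 := by
    have := variance_eq_sub (memLp_id_gaussianReal' (μ := 0) (v := 1) 2 (by norm_num))
    rw [variance_id_gaussianReal] at this
    simpa using this.symm
  rw [hv, mul_one] at h
  simp only [mul_one, integral_const, probReal_univ, smul_eq_mul] at h1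
  rw [h1, ← h]
  congr 1; ext q; simp only [GG]; ring

lemma DD_exp (V : ℝ → ℝ) (hV : Measurable V) (hVint : Integrable (fun y => Real.exp (-V y)))
    (h : ℝ) (n : ℕ)
    (hi : Integrable (fun q => |DD V (-h) q| ^ n) ((piMeasure V).prod (gaussianReal 0 1))) :
    Integrable (fun q => |DD V h q| ^ n * Real.exp (DD V h q))
      ((piMeasure V).prod (gaussianReal 0 1)) ∧
    ∫ q, |DD V h q| ^ n * Real.exp (DD V h q) ∂((piMeasure V).prod (gaussianReal 0 1)) =
      ∫ q, |DD V (-h) q| ^ n ∂((piMeasure V).prod (gaussianReal 0 1)) := by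
  have := piProb V hVint
  have hm := DD_meas V hV h
  have hm' := DD_meas V hV (-h)
  have key : ∫⁻ q, ENNReal.ofReal (|DD V h q| ^ n * Real.exp (DD V h q))
        ∂((piMeasure V).prod (gaussianReal 0 1)) =
      ∫⁻ q, ENNReal.ofReal (|DD V (-h) q| ^ n) ∂((piMeasure V).prod (gaussianReal 0 1)) := by
    rw [lintegral_prod_symm' _ (by fun_prop), lintegral_prod_symm' _ (by fun_prop)]
    apply lintegral_congr
    intro z
    have := cov V hV (fun t => ENNReal.ofReal (|t| ^ n)) (by fun_prop) (h * z)
    simp only [DD]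
    rw [← neg_mul] at this
    rw [lintegral_congr (g := fun x => ENNReal.ofReal (|V x - V (x + h * z)| ^ n) *
      ENNReal.ofReal (Real.exp (V x - V (x + h * z)))), this]
    · apply lintegral_congr
      intro x
      rw [abs_sub_comm]
    · intro x
      rw [ENNReal.ofReal_mul (by positivity)]
  have n1 : 0 ≤ᵐ[(piMeasure V).prod (gaussianReal 0 1)]
      fun q => |DD V h q| ^ n * Real.exp (DD V h q) := ae_of_all _ fun q => by positivity
  have n2 : 0 ≤ᵐ[(piMeasure V).prod (gaussianReal 0 1)]
      fun q => |DD V (-h) q| ^ n := ae_of_all _ fun q => by positivity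
  have m1 : Measurable fun q => |DD V h q| ^ n * Real.exp (DD V h q) := by fun_prop
  constructor
  · refine ⟨m1.aestronglyMeasurable, ?_⟩
    rw [hasFiniteIntegral_iff_ofReal n1, key]
    exact (hasFiniteIntegral_iff_ofReal n2).1 hi.2
  · rw [integral_eq_lintegral_of_nonneg_ae n1 m1.aestronglyMeasurable,
      integral_eq_lintegral_of_nonneg_ae n2 hi.1, key]

lemma cube_ineq (a b : ℝ) : |a - b| ^ 3 ≤ 4 * (|a| ^ 3 + |b| ^ 3) := by
  have h1 : |a - b| ≤ |a| + |b| := abs_sub a b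
  have h2 : |a - b| ^ 3 ≤ (|a| + |b|) ^ 3 := by gcongr
  have ha := abs_nonneg a
  have hb := abs_nonneg b
  nlinarith [mul_nonneg (add_nonneg ha hb) (sq_nonneg (|a| - |b|))]

set_option maxHeartbeats 1000000 in
lemma main_est (V Vdot : ℝ → ℝ) (hV : Measurable V) (hVdot : Measurable Vdot)
    (hVint : Integrable (fun y => Real.exp (-V y)))
    (p C β : ℝ) (hp : 4 < p) (hC : 0 < C) (hβ : 1 < β)
    (hH1i : ∀ θ : ℝ,
      Integrable (fun x => |V (x + θ) - V x - θ * Vdot x| ^ p) (piMeasure V) ∧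
      (∫ x, |V (x + θ) - V x - θ * Vdot x| ^ p ∂(piMeasure V)) ^ (1 / p) ≤ C * |θ| ^ β)
    (hH1ii : Integrable (fun x => |Vdot x| ^ (6 : ℝ)) (piMeasure V)) :
    ∃ K : ℝ, 0 ≤ K ∧ ∀ h : ℝ, 0 < h → h ≤ 1 →
      MemLp (fun q => RR V Vdot h q + h ^ 2 / 4 * Vdot q.1 ^ 2) 2
        ((piMeasure V).prod (gaussianReal 0 1)) ∧
      ∫ q, (RR V Vdot h q + h ^ 2 / 4 * Vdot q.1 ^ 2) ^ 2
        ∂((piMeasure V).prod (gaussianReal 0 1)) ≤ K * ((h ^ β) ^ 2 + h ^ 4) ∧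
      |(∫ q, (RR V Vdot h q + h ^ 2 / 4 * Vdot q.1 ^ 2) ∂((piMeasure V).prod (gaussianReal 0 1)))
        - 2 * ∫ q, (Real.exp (DD V h q / 2) - 1) ∂((piMeasure V).prod (gaussianReal 0 1))|
        ≤ K * (h ^ 3 + h * h ^ β) := by
  have := piProb V hVint
  obtain ⟨K1, hK1, hR⟩ := RR_bound V Vdot hV hVdot hVint p C β hp hC hβ hH1i
  obtain ⟨hv6, hG6⟩ := GG_int V Vdot hVdot hVint hH1ii
  have hGmean := GG_mean V Vdot hVint
  have hGsq := GG_sq V Vdot hVint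
  have hDexp := DD_exp V hV hVint
  have hmG := GG_meas Vdot hVdot
  have hmR := RR_meas V Vdot hV hVdot
  have hmD := DD_meas V hV
  set μ := (piMeasure V).prod (gaussianReal 0 1) with hμ
  have hv6' : MemLp (fun q : ℝ × ℝ => Vdot q.1) 6 μ := hv6.comp_fst _
  have hG1 : Integrable (GG Vdot) μ := hG6.integrable (by norm_num)
  have hG2 : Integrable (fun q => GG Vdot q ^ 2) μ :=
    (hG6.mono_exponent (p := 2) (by norm_num)).integrable_sq
  have hG3 : Integrable (fun q => |GG Vdot q| ^ 3) μ :=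
    (hG6.mono_exponent (p := (3 : ℕ)) (by norm_num)).integrable_norm_pow (by norm_num)
  have hv2 : Integrable (fun q : ℝ × ℝ => Vdot q.1 ^ 2) μ :=
    (hv6'.mono_exponent (p := 2) (by norm_num)).integrable_sq
  have hv4 : Integrable (fun q : ℝ × ℝ => Vdot q.1 ^ 4) μ := by
    have := (hv6'.mono_exponent (p := (4 : ℕ)) (by norm_num)).integrable_norm_pow (by norm_num)
    refine this.congr (ae_of_all _ fun q => ?_)
    simp only [Real.norm_eq_abs]
    exact Even.pow_abs (by decide) _
  set g2 := ∫ q, GG Vdot q ^ 2 ∂μ with hg2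
  set g3 := ∫ q, |GG Vdot q| ^ 3 ∂μ with hg3
  set v4 := ∫ q : ℝ × ℝ, Vdot q.1 ^ 4 ∂μ with hv4d
  have g2n : 0 ≤ g2 := integral_nonneg fun q => by positivity
  have g3n : 0 ≤ g3 := integral_nonneg fun q => by positivity
  have v4n : 0 ≤ v4 := integral_nonneg fun q => by positivity
  -- decomposition
  have hDR : ∀ h q, DD V h q = RR V Vdot h q - h * GG Vdot q := by
    intro h q; simp only [DD, RR, GG]; ring
  have hR1 : ∀ h, Integrable (RR V Vdot h) μ := fun h => by
    have := (hR h 1 (by norm_num) (by norm_num)).1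
    simp only [pow_one] at this
    exact (integrable_norm_iff (hmR h).aestronglyMeasurable).1 this
  have hR2 : ∀ h, Integrable (fun q => RR V Vdot h q ^ 2) μ := fun h => by
    simpa only [sq_abs] using (hR h 2 (by norm_num) (by norm_num)).1
  have hR2b : ∀ h, ∫ q, RR V Vdot h q ^ 2 ∂μ ≤ (K1 * |h| ^ β) ^ 2 := fun h => by
    simpa only [sq_abs] using (hR h 2 (by norm_num) (by norm_num)).2
  have hD1 : ∀ h, Integrable (DD V h) μ := fun h => by
    have : DD V h = fun q => RR V Vdot h q - h * GG Vdot q := funext (hDR h)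
    rw [this]
    exact (hR1 h).sub (hG1.const_mul h)
  have hD2 : ∀ h, Integrable (fun q => DD V h q ^ 2) μ := fun h => by
    have m1 : Measurable fun q => DD V h q ^ 2 := (hmD h).pow_const 2
    refine Integrable.mono' (((hR2 h).const_mul 2).add (hG2.const_mul (2 * h ^ 2)))
      m1.aestronglyMeasurable (ae_of_all _ fun q => ?_)
    rw [Real.norm_eq_abs, abs_of_nonneg (sq_nonneg _), hDR]
    simp only [Pi.add_apply]
    nlinarith [sq_nonneg (RR V Vdot h q + h * GG Vdot q)]
  have hD3le : ∀ h q, |DD V h q| ^ 3 ≤ 4 * |RR V Vdot h q| ^ 3 + 4 * |h| ^ 3 * |GG Vdot q| ^ 3 := by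
    intro h q
    rw [hDR]
    refine (cube_ineq _ _).trans (le_of_eq ?_)
    rw [abs_mul]; ring
  have hB3 : ∀ h, Integrable (fun q => 4 * |RR V Vdot h q| ^ 3 + 4 * |h| ^ 3 * |GG Vdot q| ^ 3) μ :=
    fun h => ((hR h 3 (by norm_num) (by norm_num)).1.const_mul 4).add (hG3.const_mul _)
  have hD3 : ∀ h, Integrable (fun q => |DD V h q| ^ 3) μ := fun h => by
    have m1 : Measurable fun q => |DD V h q| ^ 3 := by have := hmD h; fun_prop
    refine Integrable.mono' (hB3 h) m1.aestronglyMeasurable (ae_of_all _ fun q => ?_)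
    rw [Real.norm_eq_abs, abs_of_nonneg (by positivity)]
    exact hD3le h q
  have hD3b : ∀ h, |h| ≤ 1 → ∫ q, |DD V h q| ^ 3 ∂μ ≤ 4 * (K1 ^ 3 + g3) * |h| ^ 3 := by
    intro h hh
    have h1 : ∫ q, |DD V h q| ^ 3 ∂μ ≤ 4 * (K1 * |h| ^ β) ^ 3 + 4 * |h| ^ 3 * g3 := by
      refine (integral_mono (hD3 h) (hB3 h) (hD3le h)).trans ?_
      rw [integral_add ((hR h 3 (by norm_num) (by norm_num)).1.const_mul 4) (hG3.const_mul _),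
        integral_const_mul, integral_const_mul]
      have := (hR h 3 (by norm_num) (by norm_num)).2
      linarith
    have h2 : |h| ^ β ≤ |h| := by
      rcases eq_or_ne h 0 with rfl | h0
      · simp [Real.zero_rpow (by linarith : β ≠ 0)]
      · simpa using Real.rpow_le_rpow_of_exponent_ge (abs_pos.2 h0) hh hβ.le
    have h3 : (K1 * |h| ^ β) ^ 3 ≤ (K1 * |h|) ^ 3 := by gcongr
    nlinarith
  refine ⟨2 * K1 ^ 2 + v4 + 24 * (K1 ^ 3 + g3) + (g2 + 2 * K1 ^ 2), by positivity,
    fun h h0 h1 => ?_⟩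
  have habs : |h| = h := abs_of_pos h0
  set s := h ^ β with hs
  have s0 : 0 < s := Real.rpow_pos_of_pos h0 β
  have sh : s ≤ h := by simpa using Real.rpow_le_rpow_of_exponent_ge h0 h1 hβ.le
  have R2b := hR2b h
  rw [habs] at R2b
  have hWm : Measurable (fun q : ℝ × ℝ => RR V Vdot h q + h ^ 2 / 4 * Vdot q.1 ^ 2) := by
    have := hmR h; fun_prop
  have hWle : ∀ q : ℝ × ℝ, (RR V Vdot h q + h ^ 2 / 4 * Vdot q.1 ^ 2) ^ 2 ≤
      2 * RR V Vdot h q ^ 2 + h ^ 4 / 8 * Vdot q.1 ^ 4 := fun q => by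
    nlinarith [sq_nonneg (RR V Vdot h q - h ^ 2 / 4 * Vdot q.1 ^ 2)]
  have hWB : Integrable (fun q : ℝ × ℝ => 2 * RR V Vdot h q ^ 2 + h ^ 4 / 8 * Vdot q.1 ^ 4) μ :=
    ((hR2 h).const_mul 2).add (hv4.const_mul _)
  have hW2 : Integrable (fun q : ℝ × ℝ => (RR V Vdot h q + h ^ 2 / 4 * Vdot q.1 ^ 2) ^ 2) μ := by
    refine Integrable.mono' hWB (hWm.pow_const 2).aestronglyMeasurable (ae_of_all _ fun q => ?_)
    rw [Real.norm_eq_abs, abs_of_nonneg (by positivity)]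
    exact hWle q
  have c1 : 0 ≤ h ^ 3 + h * s := by positivity
  have c2 : 0 ≤ s ^ 2 + h ^ 4 := by positivity
  refine ⟨(memLp_two_iff_integrable_sq hWm.aestronglyMeasurable).2 hW2, ?_, ?_⟩
  · have : ∫ q : ℝ × ℝ, (RR V Vdot h q + h ^ 2 / 4 * Vdot q.1 ^ 2) ^ 2 ∂μ ≤
        2 * (K1 * s) ^ 2 + h ^ 4 / 8 * v4 := by
      refine (integral_mono hW2 hWB hWle).trans ?_
      rw [integral_add ((hR2 h).const_mul 2) (hv4.const_mul _), integral_const_mul,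
        integral_const_mul]
      linarith
    refine this.trans ?_
    have e1 : 0 ≤ (24 * (K1 ^ 3 + g3) + (g2 + 2 * K1 ^ 2)) * (s ^ 2 + h ^ 4) := by positivity
    have e2 : 0 ≤ K1 ^ 2 * h ^ 4 := by positivity
    have e3 : 0 ≤ v4 * s ^ 2 := by positivity
    have e4 : 0 ≤ v4 * h ^ 4 := by positivity
    nlinarith
  · -- integrability of the remainder
    obtain ⟨hE3, hE3b⟩ := hDexp h 3 (hD3 (-h))
    have hrem_le : ∀ q, |DD V h q - 2 * (Real.exp (DD V h q / 2) - 1) + DD V h q ^ 2 / 4| ≤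
        3 * |DD V h q| ^ 3 + 3 * (|DD V h q| ^ 3 * Real.exp (DD V h q)) := fun q =>
      (aux_exp _).trans (le_of_eq (by ring))
    have hremB : Integrable (fun q => 3 * |DD V h q| ^ 3 +
        3 * (|DD V h q| ^ 3 * Real.exp (DD V h q))) μ :=
      ((hD3 h).const_mul 3).add (hE3.const_mul 3)
    have hrem : Integrable (fun q => DD V h q - 2 * (Real.exp (DD V h q / 2) - 1)
        + DD V h q ^ 2 / 4) μ := by
      have m1 : Measurable fun q => DD V h q - 2 * (Real.exp (DD V h q / 2) - 1)
        + DD V h q ^ 2 / 4 := by have := hmD h; fun_prop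
      exact Integrable.mono' hremB m1.aestronglyMeasurable (ae_of_all _ hrem_le)
    have hremb : |∫ q, (DD V h q - 2 * (Real.exp (DD V h q / 2) - 1) + DD V h q ^ 2 / 4) ∂μ|
        ≤ 24 * (K1 ^ 3 + g3) * h ^ 3 := by
      refine (abs_integral_le_integral_abs).trans ?_
      refine (integral_mono hrem.abs hremB hrem_le).trans ?_
      rw [integral_add ((hD3 h).const_mul 3) (hE3.const_mul 3), integral_const_mul,
        integral_const_mul, hE3b]
      have a1 := hD3b h (by rw [habs]; exact h1)
      have a2 := hD3b (-h) (by rw [abs_neg, habs]; exact h1)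
      rw [abs_neg, habs] at a2
      rw [habs] at a1
      linarith
    have hZ : Integrable (fun q => Real.exp (DD V h q / 2) - 1) μ := by
      have := (((hD1 h).add ((hD2 h).div_const 4)).sub hrem).div_const 2
      refine this.congr (ae_of_all _ fun q => ?_)
      simp only [Pi.add_apply, Pi.sub_apply]
      ring
    have hQ : Integrable (fun q => h ^ 2 * GG Vdot q ^ 2 - DD V h q ^ 2) μ :=
      (hG2.const_mul _).sub (hD2 h)
    have hQB : Integrable (fun q => h * s * GG Vdot q ^ 2 + (h / s + 1) * RR V Vdot h q ^ 2) μ :=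
      (hG2.const_mul _).add ((hR2 h).const_mul _)
    have hQle : ∀ q, |h ^ 2 * GG Vdot q ^ 2 - DD V h q ^ 2| ≤
        h * s * GG Vdot q ^ 2 + (h / s + 1) * RR V Vdot h q ^ 2 := fun q => by
      have e : h ^ 2 * GG Vdot q ^ 2 - DD V h q ^ 2 =
        2 * h * GG Vdot q * RR V Vdot h q - RR V Vdot h q ^ 2 := by rw [hDR]; ring
      set r := RR V Vdot h q
      set g := GG Vdot q
      have e1 : h * s * g ^ 2 + (h / s + 1) * r ^ 2 - 2 * h * g * r - r ^ 2
          = h / s * (s * g - r) ^ 2 := by field_simp; ring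
      have e2 : h * s * g ^ 2 + (h / s + 1) * r ^ 2 + 2 * h * g * r - r ^ 2
          = h / s * (s * g + r) ^ 2 := by field_simp; ring
      have p1 : 0 ≤ h / s * (s * g - r) ^ 2 := by positivity
      have p2 : 0 ≤ h / s * (s * g + r) ^ 2 := by positivity
      rw [e, abs_le]
      constructor <;> nlinarith [sq_nonneg r]
    have hQb : |∫ q, (h ^ 2 * GG Vdot q ^ 2 - DD V h q ^ 2) ∂μ| ≤ (g2 + 2 * K1 ^ 2) * (h * s) := by
      refine (abs_integral_le_integral_abs).trans ?_
      refine (integral_mono hQ.abs hQB hQle).trans ?_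
      rw [integral_add (hG2.const_mul _) ((hR2 h).const_mul _), integral_const_mul,
        integral_const_mul]
      have q1 : (h / s + 1) * ∫ q, RR V Vdot h q ^ 2 ∂μ ≤ (h / s + 1) * (K1 * s) ^ 2 := by gcongr
      have q2 : (h / s + 1) * (K1 * s) ^ 2 = K1 ^ 2 * (h * s) + K1 ^ 2 * (s * s) := by
        field_simp
      have q3 : K1 ^ 2 * (s * s) ≤ K1 ^ 2 * (h * s) := by gcongr
      nlinarith
    have hdec : (∫ q, (RR V Vdot h q + h ^ 2 / 4 * Vdot q.1 ^ 2) ∂μ)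
        - 2 * ∫ q, (Real.exp (DD V h q / 2) - 1) ∂μ =
        (∫ q, (DD V h q - 2 * (Real.exp (DD V h q / 2) - 1) + DD V h q ^ 2 / 4) ∂μ)
        + 1 / 4 * ∫ q, (h ^ 2 * GG Vdot q ^ 2 - DD V h q ^ 2) ∂μ := by
      have i1 : ∫ q, DD V h q ∂μ = ∫ q, RR V Vdot h q ∂μ := by
        rw [integral_congr_ae (ae_of_all _ (hDR h)), integral_sub (hR1 h) (hG1.const_mul h),
          integral_const_mul, hGmean]
        ring
      have hDZ : Integrable (fun q => DD V h q - 2 * (Real.exp (DD V h q / 2) - 1)) μ :=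
        (hD1 h).sub (hZ.const_mul 2)
      rw [integral_add (hR1 h) (hv2.const_mul _), integral_const_mul, ← hGsq,
        integral_add hDZ ((hD2 h).div_const 4),
        integral_sub (hD1 h) (hZ.const_mul 2), integral_const_mul, integral_div,
        integral_sub (hG2.const_mul _) (hD2 h), integral_const_mul, i1]
      ring
    rw [hdec]
    refine (abs_add_le _ _).trans ?_
    rw [abs_mul]
    have f1 : |(1 / 4 : ℝ)| = 1 / 4 := by norm_num
    rw [f1]
    have e1 : 0 ≤ (2 * K1 ^ 2 + v4) * (h ^ 3 + h * s) := by positivity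
    have e2 : 0 ≤ 24 * (K1 ^ 3 + g3) * (h * s) := by positivity
    have e3 : 0 ≤ (g2 + 2 * K1 ^ 2) * h ^ 3 := by positivity
    have e4 : 0 ≤ (g2 + 2 * K1 ^ 2) * (h * s) := by positivity
    nlinarith

/-- Lemma 3: `lim_d E[|∑_{i=2}^d (ΔV_i^d - b^d(X_i^d, Z_i^d))|] = 0`
(stated with dimension `d+1`, coordinates indexed by `Fin (d+1)` and first
coordinate `0`). -/
theorem stmt_5
    (V Vdot : ℝ → ℝ) (hV : Measurable V) (hVdot : Measurable Vdot)
    (hVint : Integrable (fun y => Real.exp (-V y)))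
    (p C β : ℝ) (hp : 4 < p) (hC : 0 < C) (hβ : 1 < β)
    (hH1i : ∀ θ : ℝ,
      Integrable (fun x => |V (x + θ) - V x - θ * Vdot x| ^ p) (piMeasure V) ∧
      (∫ x, |V (x + θ) - V x - θ * Vdot x| ^ p ∂(piMeasure V)) ^ (1 / p) ≤ C * |θ| ^ β)
    (hH1ii : Integrable (fun x => |Vdot x| ^ (6 : ℝ)) (piMeasure V))
    (ℓ : ℝ) (hℓ : 0 < ℓ) :
    Tendsto (fun d : ℕ =>
      ∫ w : (Fin (d + 1) → ℝ) × (Fin (d + 1) → ℝ),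
        |∑ i ∈ Finset.univ.erase (0 : Fin (d + 1)),
          (dV V ℓ (d + 1) (w.1 i) (w.2 i) - bFun V Vdot ℓ (d + 1) (w.1 i) (w.2 i))|
        ∂(prodPi V (d + 1)))
      atTop (𝓝 0) := by
  have := piProb V hVint
  obtain ⟨K, hK, hest⟩ := main_est V Vdot hV hVdot hVint p C β hp hC hβ hH1i hH1ii
  set μ := (piMeasure V).prod (gaussianReal 0 1) with hμ
  -- step size
  set h : ℕ → ℝ := fun d => ℓ / Real.sqrt ((d + 1 : ℕ) : ℝ) with hh
  have hpos : ∀ d, 0 < h d := fun d => by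
    have : (0 : ℝ) < ((d + 1 : ℕ) : ℝ) := by positivity
    simp only [hh]; positivity
  have hlim : Tendsto h atTop (𝓝 0) := by
    have h1 : Tendsto (fun d : ℕ => ((d + 1 : ℕ) : ℝ)) atTop atTop :=
      tendsto_natCast_atTop_atTop.comp (tendsto_add_atTop_nat 1)
    exact (Real.tendsto_sqrt_atTop.comp h1).const_div_atTop ℓ
  have hD : ∀ d : ℕ, ((d + 1 : ℕ) : ℝ) * h d ^ 2 = ℓ ^ 2 := fun d => by
    have : (0 : ℝ) < ((d + 1 : ℕ) : ℝ) := by positivity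
    simp only [hh]
    rw [div_pow, Real.sq_sqrt this.le]
    field_simp
  -- upper bound
  set u : ℕ → ℝ := fun d => Real.sqrt (K * ℓ ^ 2 * ((h d ^ (β - 1)) ^ 2 + h d ^ 2) +
    (K * ℓ ^ 2 * (h d + h d ^ (β - 1))) ^ 2) with hu
  have hulim : Tendsto u atTop (𝓝 0) := by
    have hb : Tendsto (fun d => h d ^ (β - 1)) atTop (𝓝 0) := by
      have := hlim.rpow_const (p := β - 1) (Or.inr (by linarith))
      rwa [Real.zero_rpow (by linarith)] at this
    have h2 := ((((hb.pow 2).add (hlim.pow 2)).const_mul (K * ℓ ^ 2)).add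
      (((hlim.add hb).const_mul (K * ℓ ^ 2)).pow 2)).sqrt
    simpa using h2
  refine tendsto_of_tendsto_of_tendsto_of_le_of_le' tendsto_const_nhds hulim
    (Eventually.of_forall fun d => integral_nonneg fun w => abs_nonneg _) ?_
  filter_upwards [hlim.eventually_le_const (zero_lt_one)] with d hd1
  obtain ⟨hW, hW2, hWm⟩ := hest (h d) (hpos d) hd1
  set e : ℝ := ∫ q, (Real.exp (DD V (h d) q / 2) - 1) ∂μ with he
  set W : ℝ × ℝ → ℝ := fun q => RR V Vdot (h d) q + h d ^ 2 / 4 * Vdot q.1 ^ 2 with hWdef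
  set Y : ℝ × ℝ → ℝ := fun q => W q - 2 * e with hY
  have hYL : MemLp Y 2 μ := hW.sub (memLp_const _)
  have hstep : ∀ z : ℝ, ℓ * z / Real.sqrt ((d + 1 : ℕ) : ℝ) = h d * z := fun z => by
    simp only [hh]; ring
  have hYeq : ∀ x z, dV V ℓ (d + 1) x z - bFun V Vdot ℓ (d + 1) x z = Y (x, z) := by
    intro x z
    have hz : ∫ q : ℝ × ℝ, zeta V ℓ (d + 1) q.1 q.2 ∂((piMeasure V).prod (gaussianReal 0 1)) = e := by
      simp only [zeta, hstep]; rfl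
    have h4 : ℓ ^ 2 / (4 * ((d + 1 : ℕ) : ℝ)) = h d ^ 2 / 4 := by
      rw [← hD d]
      have : (0 : ℝ) < ((d + 1 : ℕ) : ℝ) := by positivity
      field_simp
    simp only [bFun, dV]
    rw [hz, h4, hstep]
    simp only [hY, hWdef, RR]
    ring
  have hmp := measurePreserving_arrowProdEquivProdArrow ℝ ℝ (Fin (d + 1))
    (fun _ => piMeasure V) (fun _ => gaussianReal 0 1)
  have hIntEq : ∫ w : (Fin (d + 1) → ℝ) × (Fin (d + 1) → ℝ),
        |∑ i ∈ Finset.univ.erase (0 : Fin (d + 1)),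
          (dV V ℓ (d + 1) (w.1 i) (w.2 i) - bFun V Vdot ℓ (d + 1) (w.1 i) (w.2 i))|
        ∂(prodPi V (d + 1)) =
      ∫ w : Fin (d + 1) → ℝ × ℝ, |∑ i ∈ Finset.univ.erase (0 : Fin (d + 1)), Y (w i)|
        ∂(Measure.pi fun _ => μ) := by
    simp only [hYeq]
    rw [prodPi, ← hmp.integral_comp (MeasurableEquiv.measurableEmbedding _)]
    rfl
  rw [hIntEq]
  refine (aux_sum μ Y hYL _).trans ?_
  have hcard : (((Finset.univ.erase (0 : Fin (d + 1))).card : ℕ) : ℝ) ≤ ((d + 1 : ℕ) : ℝ) := by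
    exact_mod_cast (Finset.card_erase_le.trans (by simp))
  set N : ℝ := (((Finset.univ.erase (0 : Fin (d + 1))).card : ℕ) : ℝ) with hN
  have hN0 : 0 ≤ N := Nat.cast_nonneg _
  set s := h d ^ (β - 1) with hs
  have hsβ : h d ^ β = h d * s := by
    rw [hs, ← Real.rpow_one_add' (hpos d).le (by linarith)]; congr 1; ring
  rw [hsβ] at hW2 hWm
  have hvar : Var[Y; μ] ≤ K * ((h d * s) ^ 2 + h d ^ 4) := by
    have : Var[Y; μ] = Var[W; μ] := variance_sub_const hW.1 _
    rw [this]
    exact (variance_le_expectation_sq hW.1).trans hW2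
  have hmean : |∫ q, Y q ∂μ| ≤ K * (h d ^ 3 + h d * (h d * s)) := by
    have : ∫ q, Y q ∂μ = ∫ q, W q ∂μ - 2 * e := by
      simp only [hY]
      rw [integral_sub (hW.integrable (by norm_num)) (integrable_const _)]
      simp
    rw [this]; exact hWm
  have hs0 : 0 ≤ s := Real.rpow_nonneg (hpos d).le _
  have hp := hpos d
  apply Real.sqrt_le_sqrt
  apply add_le_add
  · calc N * Var[Y; μ] ≤ ((d + 1 : ℕ) : ℝ) * (K * ((h d * s) ^ 2 + h d ^ 4)) :=
          mul_le_mul hcard hvar (variance_nonneg _ _) (by positivity)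
      _ = K * (((d + 1 : ℕ) : ℝ) * h d ^ 2) * (s ^ 2 + h d ^ 2) := by ring
      _ = _ := by rw [hD]
  · rw [← sq_abs]
    apply pow_le_pow_left₀ (abs_nonneg _)
    rw [abs_mul, abs_of_nonneg hN0]
    calc N * |∫ q, Y q ∂μ| ≤ ((d + 1 : ℕ) : ℝ) * (K * (h d ^ 3 + h d * (h d * s))) := by gcongr
      _ = K * (((d + 1 : ℕ) : ℝ) * h d ^ 2) * (h d + s) := by ring
      _ = _ := by rw [hD]
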